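/- In R^8 with the standard inner product, let Φ+ be the set of positive roots of E7 consisting of the vectors ε_i − ε_j with i < j ≤ 7 or i = 8 and j ≤ 7, and ε_i + ε_j + ε_k + ε_8 with i, j, k pairwise distinct elements of {1,…,7}; let h = 2ε1 − 2ε3 + ε6 − ε7. Then exactly 12 elements α of Φ+ satisfy ⟨α, h⟩ = 1, their sum is κ = 5ε1 + 4ε2 + ε3 + 4ε4 + 4ε5 + 3ε6 − ε7 + 8ε8, and the inner product of κ with each of the four vectors ε1+ε2+ε3−3ε8, 3ε8−ε5−ε6−ε7, 2ε8−ε6−ε7, 4ε8 is an even integer; consequently κ/2 takes integer values on the lattice spanned by these four vectors. -/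

import Mathlib

/-!
STATEMENT 11. In `ℝ⁸` with the standard inner product, let `Φ⁺` be the set of
positive roots of `E₇` consisting of the vectors `ε_i − ε_j` with `i < j ≤ 7`
or `i = 8, j ≤ 7`, and `ε_i + ε_j + ε_k + ε_8` with `i, j, k` pairwise distinct
in `{1,…,7}`; let `h = 2ε₁ − 2ε₃ + ε₆ − ε₇`. Then exactly 12 elements `α` of
`Φ⁺` satisfy `⟨α, h⟩ = 1`, their sum is
`κ = 5ε₁ + 4ε₂ + ε₃ + 4ε₄ + 4ε₅ + 3ε₆ − ε₇ + 8ε₈`, the inner product of `κ`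
with each of `ε₁+ε₂+ε₃−3ε₈`, `3ε₈−ε₅−ε₆−ε₇`, `2ε₈−ε₆−ε₇`, `4ε₈` is an even
integer, and consequently `κ/2` takes integer values on the lattice spanned by
these four vectors.

Indices are shifted down by one: `ε_i` of the statement is `eps8 (i-1)`.
-/

open Finset

/-- the standard basis vector `ε_{i+1}` of `ℝ⁸` -/
def eps8 (i : Fin 8) : Fin 8 → ℝ := fun j => if j = i then 1 else 0

/-- the standard inner product on `ℝ⁸` -/
def ip8 (x y : Fin 8 → ℝ) : ℝ := ∑ j, x j * y j

/-- the positive roots of `E₇`: `ε_i − ε_j` with `i < j ≤ 7` or `i = 8, j ≤ 7`,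
and `ε_i + ε_j + ε_k + ε_8` with `i, j, k` pairwise distinct in `{1,…,7}` -/
noncomputable def PhiPlusE7 : Finset (Fin 8 → ℝ) :=
  ((univ : Finset (Fin 8 × Fin 8)).filter
      (fun p => (p.1 < p.2 ∧ p.2 ≤ (6 : Fin 8)) ∨ (p.1 = (7 : Fin 8) ∧ p.2 ≤ (6 : Fin 8)))).image
    (fun p => eps8 p.1 - eps8 p.2) ∪
  ((univ : Finset (Fin 8 × Fin 8 × Fin 8)).filter
      (fun t => t.1 ≤ (6 : Fin 8) ∧ t.2.1 ≤ (6 : Fin 8) ∧ t.2.2 ≤ (6 : Fin 8) ∧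
        t.1 ≠ t.2.1 ∧ t.1 ≠ t.2.2 ∧ t.2.1 ≠ t.2.2)).image
    (fun t => eps8 t.1 + eps8 t.2.1 + eps8 t.2.2 + eps8 7)

/-- `h = 2ε₁ − 2ε₃ + ε₆ − ε₇`, the semisimple element of an `sl₂`-triple for
the nilpotent orbit `A2+A1` in `E₇` -/
noncomputable def hE7 : Fin 8 → ℝ := ![2, 0, -2, 0, 0, 1, -1, 0]

/-- `κ = 5ε₁ + 4ε₂ + ε₃ + 4ε₄ + 4ε₅ + 3ε₆ − ε₇ + 8ε₈` -/
noncomputable def kappaE7 : Fin 8 → ℝ := ![5, 4, 1, 4, 4, 3, -1, 8]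

/-- the basis `ε₁+ε₂+ε₃−3ε₈`, `3ε₈−ε₅−ε₆−ε₇`, `2ε₈−ε₆−ε₇`, `4ε₈` of the
intersection of `t` with the coroot lattice -/
noncomputable def latticeBasisE7 : List (Fin 8 → ℝ) :=
  [![1, 1, 1, 0, 0, 0, 0, -3], ![0, 0, 0, 0, -1, -1, -1, 3],
   ![0, 0, 0, 0, 0, -1, -1, 2], ![0, 0, 0, 0, 0, 0, 0, 4]]

def eps8Z (i : Fin 8) : Fin 8 → ℤ := fun j => if j = i then 1 else 0

def ip8Z (x y : Fin 8 → ℤ) : ℤ := ∑ j, x j * y j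

def PhiZ : Finset (Fin 8 → ℤ) :=
  ((univ : Finset (Fin 8 × Fin 8)).filter
      (fun p => (p.1 < p.2 ∧ p.2 ≤ (6 : Fin 8)) ∨ (p.1 = (7 : Fin 8) ∧ p.2 ≤ (6 : Fin 8)))).image
    (fun p => eps8Z p.1 - eps8Z p.2) ∪
  ((univ : Finset (Fin 8 × Fin 8 × Fin 8)).filter
      (fun t => t.1 ≤ (6 : Fin 8) ∧ t.2.1 ≤ (6 : Fin 8) ∧ t.2.2 ≤ (6 : Fin 8) ∧
        t.1 ≠ t.2.1 ∧ t.1 ≠ t.2.2 ∧ t.2.1 ≠ t.2.2)).image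
    (fun t => eps8Z t.1 + eps8Z t.2.1 + eps8Z t.2.2 + eps8Z 7)

def hZ : Fin 8 → ℤ := ![2, 0, -2, 0, 0, 1, -1, 0]

def kappaZ : Fin 8 → ℤ := ![5, 4, 1, 4, 4, 3, -1, 8]

def castV (x : Fin 8 → ℤ) : Fin 8 → ℝ := fun j => (x j : ℝ)

theorem castV_inj : Function.Injective castV := by
  intro x y h
  funext j
  have := congrFun h j
  simpa [castV] using this

theorem eps8_cast (i : Fin 8) : eps8 i = castV (eps8Z i) := by
  funext j
  simp [eps8, castV, eps8Z]

theorem hE7_cast : hE7 = castV hZ := by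
  funext j
  fin_cases j <;> simp [hE7, castV, hZ]

theorem kappaE7_cast : kappaE7 = castV kappaZ := by
  funext j
  fin_cases j <;> simp [kappaE7, castV, kappaZ]

theorem ip8_cast (x y : Fin 8 → ℤ) : ip8 (castV x) (castV y) = (ip8Z x y : ℝ) := by
  simp [ip8, ip8Z, castV]

theorem Phi_cast : PhiPlusE7 = PhiZ.image castV := by
  unfold PhiPlusE7 PhiZ
  rw [image_union, image_image, image_image]
  refine congrArg₂ (· ∪ ·) (image_congr fun p _ => ?_) (image_congr fun p _ => ?_)
  · funext j
    simp [eps8_cast, castV]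
  · funext j
    simp [eps8_cast, castV]

theorem filter_cast_aux (S : Finset (Fin 8 → ℤ)) :
    (S.image castV).filter (fun α => ip8 α hE7 = 1) =
    (S.filter (fun α => ip8Z α hZ = 1)).image castV := by
  have key : ∀ x, ip8 (castV x) hE7 = 1 ↔ ip8Z x hZ = 1 := by
    intro x
    rw [hE7_cast, ip8_cast]
    norm_cast
  ext v
  simp only [mem_filter, mem_image]
  constructor
  · rintro ⟨⟨x, hx, rfl⟩, h⟩
    exact ⟨x, ⟨hx, (key x).1 h⟩, rfl⟩
  · rintro ⟨x, ⟨hx, h⟩, rfl⟩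
    exact ⟨⟨x, hx, rfl⟩, (key x).2 h⟩

theorem filter_cast : PhiPlusE7.filter (fun α => ip8 α hE7 = 1) =
    (PhiZ.filter (fun α => ip8Z α hZ = 1)).image castV := by
  rw [Phi_cast]
  exact filter_cast_aux PhiZ

set_option maxRecDepth 100000 in
theorem cardZ : (PhiZ.filter (fun α => ip8Z α hZ = 1)).card = 12 := by
  decide +kernel

set_option maxRecDepth 100000 in
theorem sumZ : (∑ α ∈ PhiZ.filter (fun α => ip8Z α hZ = 1), α) = kappaZ := by
  decide +kernel

theorem even_basis : ∀ v ∈ latticeBasisE7, ∃ m : ℤ, ip8 kappaE7 v = 2 * m := by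
  intro v hv
  simp only [latticeBasisE7, List.mem_cons, List.not_mem_nil, or_false] at hv
  rcases hv with rfl | rfl | rfl | rfl
  · exact ⟨-7, by simp [ip8, kappaE7, Fin.sum_univ_succ]; norm_num⟩
  · exact ⟨9, by simp [ip8, kappaE7, Fin.sum_univ_succ]; norm_num⟩
  · exact ⟨7, by simp [ip8, kappaE7, Fin.sum_univ_succ]; norm_num⟩
  · exact ⟨16, by simp [ip8, kappaE7, Fin.sum_univ_succ]; norm_num⟩

/-- **Example 3.6**: the computation for the orbit `A2+A1` in `E₇`. -/
theorem e7_A2plusA1_kappa_computation :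
    (PhiPlusE7.filter (fun α => ip8 α hE7 = 1)).card = 12 ∧
    (∑ α ∈ PhiPlusE7.filter (fun α => ip8 α hE7 = 1), α) = kappaE7 ∧
    (∀ v ∈ latticeBasisE7, ∃ m : ℤ, ip8 kappaE7 v = 2 * m) ∧
    (∀ x ∈ Submodule.span ℤ {v : Fin 8 → ℝ | v ∈ latticeBasisE7},
      ∃ m : ℤ, ip8 ((2 : ℝ)⁻¹ • kappaE7) x = m) := by
  refine ⟨?_, ?_, even_basis, ?_⟩
  · rw [filter_cast, card_image_of_injective _ castV_inj, cardZ]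
  · rw [filter_cast, sum_image castV_inj.injOn, kappaE7_cast, ← sumZ]
    funext j
    simp [castV]
  · intro x hx
    induction hx using Submodule.span_induction with
    | mem v hv =>
      obtain ⟨m, hm⟩ := even_basis v hv
      refine ⟨m, ?_⟩
      have : ip8 ((2 : ℝ)⁻¹ • kappaE7) v = 2⁻¹ * ip8 kappaE7 v := by
        simp [ip8, mul_sum, mul_assoc]
      rw [this, hm]
      ring
    | zero => exact ⟨0, by simp [ip8]⟩
    | add x y _ _ hx hy =>
      obtain ⟨a, ha⟩ := hx
      obtain ⟨b, hb⟩ := hy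
      refine ⟨a + b, ?_⟩
      push_cast
      rw [← ha, ← hb]
      simp only [ip8, Pi.add_apply, mul_add, sum_add_distrib]
    | smul c x _ hx =>
      obtain ⟨a, ha⟩ := hx
      refine ⟨c * a, ?_⟩
      push_cast
      rw [← ha]
      simp only [ip8, mul_sum]
      refine sum_congr rfl fun j _ => ?_
      rw [Pi.smul_apply c x j, zsmul_eq_mul]
      ring
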